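/- (Transversality, second Melnikov with sum.) There exist m₀ ∈ ℕ and ρ₀ > 0 such that for every κ ∈ [κ₁, κ₂], every ℓ ∈ ℤ^ν and every j, j' ∈ S₀ᶜ satisfying the momentum condition j⃗·ℓ + j + j' = 0: max over 0 ≤ n ≤ m₀ of |∂_κ^n ( Ω⃗(κ)·ℓ + Ω_j(κ) + Ω_{j'}(κ) )| ≥ ρ₀·⟨ℓ⟩. -/

import Mathlib

open Real Finset Set

/-- `G_j := j · tanh(dpt · j)` (finite depth `dpt`). -/
noncomputable def Gfun (dpt : ℝ) (j : ℤ) : ℝ := (j : ℝ) * Real.tanh (dpt * (j : ℝ))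

/-- The linear frequencies `ω_j(κ)`. -/
noncomputable def omegaF (dpt g γ : ℝ) (j : ℤ) (κ : ℝ) : ℝ :=
  Real.sqrt (κ * Gfun dpt j * (j : ℝ) ^ 2 + g * Gfun dpt j + (γ * Gfun dpt j / (2 * (j : ℝ))) ^ 2)

/-- The linear frequencies `Ω_j(κ) = ω_j(κ) + (γ/2) G_j / j`. -/
noncomputable def OmegaF (dpt g γ : ℝ) (j : ℤ) (κ : ℝ) : ℝ :=
  omegaF dpt g γ j κ + γ / 2 * Gfun dpt j / (j : ℝ)

/-- If the moments `∑ W i * x i ^ k`, `k ≤ K`, are bounded by `M`, so are the sums of `W` against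
products of at most `K` linear factors, up to a power of `1 + B`. -/
theorem abs_sum_mul_prod_sub_le {ι : Type*} [Fintype ι] (W x y : ι → ℝ) {B M : ℝ} {K : ℕ}
    (hB : ∀ i, |y i| ≤ B) (hM : ∀ k ≤ K, |∑ i, W i * x i ^ k| ≤ M) (s : Finset ι) :
    ∀ k, k + s.card ≤ K →
      |∑ i, W i * (∏ m ∈ s, (x i - y m)) * x i ^ k| ≤ (1 + B) ^ s.card * M := by
  classical
  induction s using Finset.induction_on with
  | empty => intro k hk; simpa using hM k (by simpa using hk)
  | insert a s ha ih =>
    intro k hk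
    rw [card_insert_of_notMem ha] at hk ⊢
    have h1 := ih (k + 1) (by omega)
    have h2 := ih k (by omega)
    have hB0 : 0 ≤ B := (abs_nonneg _).trans (hB a)
    have split : ∑ i, W i * (∏ m ∈ insert a s, (x i - y m)) * x i ^ k
        = ∑ i, W i * (∏ m ∈ s, (x i - y m)) * x i ^ (k + 1)
          - y a * ∑ i, W i * (∏ m ∈ s, (x i - y m)) * x i ^ k := by
      rw [mul_sum, ← sum_sub_distrib]
      refine sum_congr rfl fun i _ => ?_
      rw [prod_insert ha]
      ring
    rw [split]
    refine (abs_sub _ _).trans ?_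
    rw [abs_mul]
    have h3 := mul_le_mul (hB a) h2 (abs_nonneg _) hB0
    calc _ ≤ (1 + B) ^ s.card * M + B * ((1 + B) ^ s.card * M) := add_le_add h1 h3
      _ = _ := by ring

theorem tanh_pos_of_pos {x : ℝ} (hx : 0 < x) : 0 < tanh x := by
  rw [tanh_eq_sinh_div_cosh]
  exact div_pos (sinh_pos_iff.2 hx) (cosh_pos x)

theorem tanh_monotone : Monotone tanh := fun x y hxy =>
  (artanh_le_artanh_iff ⟨neg_one_lt_tanh x, tanh_lt_one x⟩ ⟨neg_one_lt_tanh y, tanh_lt_one y⟩).1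
    (by simpa only [artanh_tanh] using hxy)

theorem antitoneOn_tanh_div_self : AntitoneOn (fun x : ℝ => tanh x / x) (Ioi 0) := by
  have key : ∀ x ∈ Ioi (0 : ℝ), HasDerivAt (fun x : ℝ => sinh x / cosh x / x)
      (((cosh x * cosh x - sinh x * sinh x) / cosh x ^ 2 * x - sinh x / cosh x * 1) / x ^ 2) x :=
    fun x hx => ((hasDerivAt_sinh x).div (hasDerivAt_cosh x) (cosh_pos x).ne').div
      (hasDerivAt_id x) (ne_of_gt hx)
  simp only [tanh_eq_sinh_div_cosh]
  refine antitoneOn_of_deriv_nonpos (convex_Ioi 0)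
    (fun x hx => (key x hx).continuousAt.continuousWithinAt)
    (fun x hx => (key x (interior_subset hx)).differentiableAt.differentiableWithinAt) ?_
  intro x hx
  have hx0 : 0 < x := by simpa using hx
  rw [(key x hx0).deriv]
  refine div_nonpos_of_nonpos_of_nonneg ?_ (sq_nonneg x)
  have h1 : x ≤ sinh x := self_le_sinh_iff.2 hx0.le
  have h2 := one_le_cosh x
  have h3 : cosh x * cosh x - sinh x * sinh x = 1 := by
    have := cosh_sq x
    nlinarith
  rw [h3]
  have h4 : 1 / cosh x ^ 2 * x - sinh x / cosh x * 1 = (x - sinh x * cosh x) / cosh x ^ 2 := by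
    field_simp
  rw [h4]
  exact div_nonpos_of_nonpos_of_nonneg (by nlinarith) (sq_nonneg _)

/-- `ω_j(κ) = waveAmp |j| * √(κ + waveShift |j|)`. -/
noncomputable def waveShift (dpt g γ : ℝ) (n : ℕ) : ℝ :=
  g / (n : ℝ) ^ 2 + γ ^ 2 / 4 * (tanh (dpt * n) / (n : ℝ) ^ 3)

/-- The amplitude of the `n`-th mode, see `waveShift`. -/
noncomputable def waveAmp (dpt : ℝ) (n : ℕ) : ℝ := √((n : ℝ) ^ 3 * tanh (dpt * n))

theorem waveShift_strictAnti {dpt g γ : ℝ} (hdpt : 0 < dpt) (hg : 0 < g) {m n : ℕ} (hm : 0 < m)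
    (hmn : m < n) : waveShift dpt g γ n < waveShift dpt g γ m := by
  have hm' : (0 : ℝ) < m := by exact_mod_cast hm
  have hmn' : (m : ℝ) < n := by exact_mod_cast hmn
  have hn' : (0 : ℝ) < n := hm'.trans hmn'
  have h1 : g / (n : ℝ) ^ 2 < g / (m : ℝ) ^ 2 := by gcongr
  have h2 : tanh (dpt * n) / (dpt * n) ≤ tanh (dpt * m) / (dpt * m) :=
    antitoneOn_tanh_div_self (mul_pos hdpt hm') (mul_pos hdpt hn') (by gcongr)
  have e : ∀ r : ℝ, 0 < r →
      tanh (dpt * r) / r ^ 3 = tanh (dpt * r) / (dpt * r) * (dpt / r ^ 2) := by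
    intro r hr
    field_simp
  have h3 : tanh (dpt * n) / (n : ℝ) ^ 3 ≤ tanh (dpt * m) / (m : ℝ) ^ 3 := by
    rw [e _ hn', e _ hm']
    refine mul_le_mul h2 (by gcongr) (by positivity) ?_
    exact (div_pos (tanh_pos_of_pos (by positivity)) (by positivity)).le
  unfold waveShift
  have := mul_le_mul_of_nonneg_left h3 (by positivity : 0 ≤ γ ^ 2 / 4)
  linarith

theorem waveShift_pos {dpt g : ℝ} (γ : ℝ) (hdpt : 0 < dpt) (hg : 0 < g) {n : ℕ} (hn : 0 < n) :
    0 < waveShift dpt g γ n := by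
  have hn' : (0 : ℝ) < n := by exact_mod_cast hn
  have := tanh_pos_of_pos (mul_pos hdpt hn')
  unfold waveShift
  positivity

theorem waveShift_le_one {dpt g : ℝ} (γ : ℝ) (hdpt : 0 < dpt) (hg : 0 < g) {n : ℕ} (hn : 0 < n) :
    waveShift dpt g γ n ≤ waveShift dpt g γ 1 := by
  rcases (Nat.succ_le_of_lt hn).eq_or_lt with h | h
  · rw [← h]
  · exact (waveShift_strictAnti hdpt hg one_pos h).le

theorem waveShift_separated {dpt g : ℝ} (γ : ℝ) (hdpt : 0 < dpt) (hg : 0 < g) {n : ℕ}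
    (hn : 0 < n) : ∃ δ > 0, ∀ m : ℕ, 0 < m → m ≠ n →
      δ ≤ |waveShift dpt g γ n - waveShift dpt g γ m| := by
  have anti {p q : ℕ} (hp : 0 < p) (hpq : p ≤ q) :
      waveShift dpt g γ q ≤ waveShift dpt g γ p := by
    rcases hpq.eq_or_lt with rfl | h
    · rfl
    · exact (waveShift_strictAnti hdpt hg hp h).le
  have hup := waveShift_strictAnti (γ := γ) hdpt hg hn n.lt_succ_self
  rcases Nat.eq_or_lt_of_le (Nat.succ_le_of_lt hn) with h1 | h1
  · refine ⟨_, sub_pos.2 hup, fun m hm hmn => le_trans ?_ (le_abs_self _)⟩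
    have := anti (p := n + 1) (q := m) (by omega) (by omega)
    exact sub_le_sub_left this _
  · have hdown := waveShift_strictAnti (γ := γ) (m := n - 1) (n := n) hdpt hg (by omega) (by omega)
    refine ⟨_, lt_min (sub_pos.2 hup) (sub_pos.2 hdown), fun m hm hmn => ?_⟩
    rcases lt_or_gt_of_ne hmn with h | h
    · refine (min_le_right _ _).trans (le_trans ?_ (neg_le_abs _))
      have := anti (p := m) (q := n - 1) (by omega) (by omega)
      linarith
    · refine (min_le_left _ _).trans (le_trans ?_ (le_abs_self _))
      exact sub_le_sub_left (anti (by omega) h) _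

theorem waveAmp_one_le {dpt : ℝ} (hdpt : 0 < dpt) {n : ℕ} (hn : 0 < n) :
    waveAmp dpt 1 ≤ waveAmp dpt n := by
  have hn' : (1 : ℝ) ≤ n := by exact_mod_cast hn
  have h : tanh (dpt * 1) ≤ tanh (dpt * n) :=
    tanh_monotone (mul_le_mul_of_nonneg_left hn' hdpt.le)
  have h0 := tanh_pos_of_pos (by linarith : 0 < dpt * 1)
  refine Real.sqrt_le_sqrt ?_
  push_cast
  exact mul_le_mul (by gcongr) h h0.le (by positivity)

theorem waveAmp_one_pos {dpt : ℝ} (hdpt : 0 < dpt) : 0 < waveAmp dpt 1 := by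
  have := tanh_pos_of_pos hdpt
  simpa [waveAmp] using this

theorem hasDerivAt_sqrt_mul_inv_pow (n : ℕ) {c t : ℝ} (h : 0 < t + c) :
    HasDerivAt (fun t => √(t + c) * (t + c)⁻¹ ^ n)
      ((1 / 2 - n) * (√(t + c) * (t + c)⁻¹ ^ (n + 1))) t := by
  have h1 : HasDerivAt (fun t => t + c) 1 t := (hasDerivAt_id t).add_const c
  have h2 := (h1.sqrt h.ne').mul ((h1.inv h.ne').pow n)
  refine h2.congr_deriv ?_
  have hs : 1 / (2 * √(t + c)) = √(t + c) * (t + c)⁻¹ / 2 := by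
    rw [← div_eq_mul_inv, sqrt_div_self]
    ring
  have hi : -1 / (t + c) ^ 2 = -(t + c)⁻¹ ^ 2 := by rw [inv_pow, neg_div, one_div]
  simp only [Pi.pow_apply, Pi.inv_apply]
  rw [hs, hi]
  rcases n with _ | n
  · simp only [Nat.cast_zero]
    ring
  · simp only [Nat.add_sub_cancel]
    push_cast
    ring

theorem iteratedDeriv_sum_sqrt {ι : Type*} [Fintype ι] (a c : ι → ℝ) (hc : ∀ i, 0 < c i) (C : ℝ)
    (n : ℕ) : ∀ κ > 0, iteratedDeriv (n + 1) (fun t => (∑ i, a i * √(t + c i)) + C) κ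
      = (∏ k ∈ range (n + 1), (1 / 2 - (k : ℝ))) *
        ∑ i, a i * (√(κ + c i) * (κ + c i)⁻¹ ^ (n + 1)) := by
  induction n with
  | zero =>
    intro κ hκ
    have h : HasDerivAt (fun t => (∑ i, a i * √(t + c i)) + C)
        (∑ i, a i * ((1 / 2 - ((0 : ℕ) : ℝ)) * (√(κ + c i) * (κ + c i)⁻¹ ^ (0 + 1)))) κ := by
      refine HasDerivAt.add_const C (HasDerivAt.fun_sum fun i _ => HasDerivAt.const_mul (a i) ?_)
      simpa using hasDerivAt_sqrt_mul_inv_pow 0 (add_pos hκ (hc i))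
    rw [iteratedDeriv_one, h.deriv, prod_range_one, mul_sum]
    exact sum_congr rfl fun i _ => by ring
  | succ n ih =>
    intro κ hκ
    have he := Filter.eventuallyEq_of_mem (Ioi_mem_nhds hκ) ih
    rw [iteratedDeriv_succ, he.deriv_eq]
    have h : HasDerivAt (fun t => (∏ k ∈ range (n + 1), (1 / 2 - (k : ℝ))) *
        ∑ i, a i * (√(t + c i) * (t + c i)⁻¹ ^ (n + 1)))
        ((∏ k ∈ range (n + 1), (1 / 2 - (k : ℝ))) * ∑ i, a i *
          ((1 / 2 - ((n + 1 : ℕ) : ℝ)) * (√(κ + c i) * (κ + c i)⁻¹ ^ (n + 1 + 1)))) κ :=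
      HasDerivAt.const_mul _ (HasDerivAt.fun_sum fun i _ => HasDerivAt.const_mul (a i)
        (hasDerivAt_sqrt_mul_inv_pow (n + 1) (add_pos hκ (hc i))))
    rw [h.deriv, prod_range_succ _ (n + 1), mul_assoc, mul_sum _ _ (1 / 2 - ((n + 1 : ℕ) : ℝ))]
    congr 1
    exact sum_congr rfl fun i _ => by ring

theorem half_pow_le_abs_prod (n : ℕ) :
    (1 / 2 : ℝ) ^ n ≤ |∏ k ∈ range n, (1 / 2 - (k : ℝ))| := by
  rw [abs_prod, ← card_range n, ← prod_const, card_range]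
  refine prod_le_prod (fun _ _ => by norm_num) fun k _ => ?_
  rcases k with _ | k
  · norm_num
  · have : (0 : ℝ) ≤ k := k.cast_nonneg
    push_cast
    rw [le_abs]
    right
    linarith

/-- Twice the coefficient of the `n`-th mode in the first derivative. -/
noncomputable def waveWeight (dpt g γ κ : ℝ) (n : ℕ) : ℝ :=
  waveAmp dpt n * (√(κ + waveShift dpt g γ n) * (κ + waveShift dpt g γ n)⁻¹)

theorem waveWeight_lower_bound {dpt g κ₁ κ₂ : ℝ} (γ : ℝ) (hdpt : 0 < dpt) (hg : 0 < g)
    (hκ₁ : 0 < κ₁) (hκ₁₂ : κ₁ < κ₂) :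
    ∃ w > 0, ∀ κ ∈ Icc κ₁ κ₂, ∀ n : ℕ, 0 < n → w ≤ waveWeight dpt g γ κ n := by
  have hT : 0 < κ₂ + waveShift dpt g γ 1 :=
    add_pos (hκ₁.trans hκ₁₂) (waveShift_pos γ hdpt hg one_pos)
  refine ⟨waveAmp dpt 1 * (√(κ₂ + waveShift dpt g γ 1))⁻¹,
    mul_pos (waveAmp_one_pos hdpt) (inv_pos.2 (Real.sqrt_pos.2 hT)), fun κ hκ n hn => ?_⟩
  have h0 : 0 < κ + waveShift dpt g γ n :=
    add_pos (hκ₁.trans_le hκ.1) (waveShift_pos γ hdpt hg hn)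
  rw [waveWeight, ← div_eq_mul_inv √_, sqrt_div_self]
  refine mul_le_mul (waveAmp_one_le hdpt hn) ?_ (by positivity)
    ((waveAmp_one_pos hdpt).le.trans (waveAmp_one_le hdpt hn))
  have := Real.sqrt_pos.2 h0
  gcongr
  · exact hκ.2
  · exact waveShift_le_one γ hdpt hg hn

/-- The total coefficient of the `n`-th mode is controlled by the first moments, uniformly in the
other modes. -/
theorem abs_sum_coeff_le {dpt g κ₁ κ₂ : ℝ} (γ : ℝ) (hdpt : 0 < dpt) (hg : 0 < g)
    (hκ₁ : 0 < κ₁) (hκ₁₂ : κ₁ < κ₂) (ι : Type*) [Fintype ι] {n : ℕ} (hn : 0 < n) :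
    ∃ ρ > 0, ∀ κ ∈ Icc κ₁ κ₂, ∀ N : ι → ℕ, (∀ i, 0 < N i) → ∀ (q : ι → ℝ) (M : ℝ),
      (∀ k ≤ Fintype.card ι, |∑ i, q i * waveWeight dpt g γ κ (N i) *
        (κ + waveShift dpt g γ (N i))⁻¹ ^ k| ≤ M) →
      ρ * |∑ i, if N i = n then q i else 0| ≤ M := by
  obtain ⟨δ, hδ, hsep⟩ := waveShift_separated γ hdpt hg hn
  obtain ⟨w, hw, hwle⟩ := waveWeight_lower_bound γ hdpt hg hκ₁ hκ₁₂
  set T := κ₂ + waveShift dpt g γ 1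
  have hT : 0 < T := add_pos (hκ₁.trans hκ₁₂) (waveShift_pos γ hdpt hg one_pos)
  set ε := min 1 (δ * (T⁻¹ * T⁻¹))
  have hε : 0 < ε := lt_min one_pos (by positivity)
  set P := (1 + κ₁⁻¹) ^ Fintype.card ι
  have hP : 0 < P := by positivity
  refine ⟨w * ε ^ Fintype.card ι / P, by positivity, fun κ hκ N hN q M hM => ?_⟩
  have hM0 : 0 ≤ M := (abs_nonneg _).trans (hM 0 (Nat.zero_le _))
  set x : ℕ → ℝ := fun m => (κ + waveShift dpt g γ m)⁻¹ with hx
  have hpos : ∀ m : ℕ, 0 < m → 0 < κ + waveShift dpt g γ m := fun m hm =>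
    add_pos (hκ₁.trans_le hκ.1) (waveShift_pos γ hdpt hg hm)
  have hxlow : ∀ m : ℕ, 0 < m → T⁻¹ ≤ x m := fun m hm =>
    inv_anti₀ (hpos m hm) (add_le_add hκ.2 (waveShift_le_one γ hdpt hg hm))
  have hxup : ∀ m : ℕ, 0 < m → |x m| ≤ κ₁⁻¹ := fun m hm => by
    rw [abs_of_pos (inv_pos.2 (hpos m hm))]
    exact inv_anti₀ hκ₁ (by linarith [hκ.1, waveShift_pos γ hdpt hg hm])
  have hxsep : ∀ m : ℕ, 0 < m → m ≠ n → ε ≤ |x n - x m| := fun m hm hmn => by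
    have e : x n - x m = (waveShift dpt g γ m - waveShift dpt g γ n) * (x n * x m) := by
      have h1 := (hpos m hm).ne'
      have h2 := (hpos n hn).ne'
      simp only [hx]
      field_simp
      ring
    have hTi : 0 < T⁻¹ := inv_pos.2 hT
    have h3 : T⁻¹ * T⁻¹ ≤ x n * x m :=
      mul_le_mul (hxlow n hn) (hxlow m hm) hTi.le (hTi.le.trans (hxlow n hn))
    rw [e, abs_mul, abs_sub_comm, abs_of_pos ((mul_pos hTi hTi).trans_le h3)]
    exact (min_le_right _ _).trans
      (mul_le_mul (hsep m hm hmn) h3 (mul_pos hTi hTi).le (abs_nonneg _))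
  set s : Finset ι := univ.filter fun i => N i ≠ n with hs
  have hcard : s.card ≤ Fintype.card ι := card_le_univ s
  have hbound := abs_sum_mul_prod_sub_le (fun i => q i * waveWeight dpt g γ κ (N i))
    (fun i => x (N i)) (fun i => x (N i)) (fun i => hxup _ (hN i)) hM s 0 (by omega)
  have hsum : ∑ i, q i * waveWeight dpt g γ κ (N i) * (∏ m ∈ s, (x (N i) - x (N m))) * x (N i) ^ 0
      = (∑ i, if N i = n then q i else 0) *
        (waveWeight dpt g γ κ n * ∏ m ∈ s, (x n - x (N m))) := by
    rw [sum_mul]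
    refine sum_congr rfl fun i _ => ?_
    by_cases hi : N i = n
    · rw [if_pos hi, hi]
      ring
    · rw [if_neg hi, prod_eq_zero (i := i) (by simp [hs, hi]) (sub_self _)]
      ring
  rw [hsum, abs_mul, abs_mul, abs_prod] at hbound
  have h1 : ε ^ Fintype.card ι ≤ ∏ m ∈ s, |x n - x (N m)| :=
    calc ε ^ Fintype.card ι ≤ ε ^ s.card :=
          pow_le_pow_of_le_one hε.le (min_le_left _ _) hcard
      _ = ∏ _m ∈ s, ε := (prod_const ε).symm
      _ ≤ _ := prod_le_prod (fun _ _ => hε.le) fun m hm =>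
          hxsep _ (hN m) (by simpa [hs] using hm)
  have h2 : w * ε ^ Fintype.card ι ≤
      |waveWeight dpt g γ κ n| * ∏ m ∈ s, |x n - x (N m)| :=
    mul_le_mul ((hwle κ hκ n hn).trans (le_abs_self _)) h1 (by positivity) (abs_nonneg _)
  have h3 : (1 + κ₁⁻¹) ^ s.card * M ≤ P * M :=
    mul_le_mul_of_nonneg_right
      (pow_le_pow_right₀ (by linarith [inv_pos.2 hκ₁]) hcard) hM0
  rw [div_mul_eq_mul_div, div_le_iff₀ hP]
  calc _ ≤ |∑ i, if N i = n then q i else 0| *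
        (|waveWeight dpt g γ κ n| * ∏ m ∈ s, |x n - x (N m)|) := by
        rw [mul_comm]
        exact mul_le_mul_of_nonneg_left h2 (abs_nonneg _)
    _ ≤ M * P := by linarith

theorem omegaF_eq (dpt g γ : ℝ) (hdpt : 0 < dpt) {j : ℤ} (hj : j ≠ 0) (κ : ℝ) :
    omegaF dpt g γ j κ = waveAmp dpt j.natAbs * √(κ + waveShift dpt g γ j.natAbs) := by
  have hn : (0 : ℝ) < j.natAbs := by exact_mod_cast Int.natAbs_pos.2 hj
  have hG : Gfun dpt j = (j.natAbs : ℝ) * tanh (dpt * j.natAbs) := by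
    rcases Int.natAbs_eq j with h | h
    · rw [Gfun]
      nth_rw 1 2 [h]
      simp
    · rw [Gfun]
      nth_rw 1 2 [h]
      simp [tanh_neg]
  have hsq : (j : ℝ) ^ 2 = (j.natAbs : ℝ) ^ 2 := by
    rw [Nat.cast_natAbs, Int.cast_abs, sq_abs]
  have ht := tanh_pos_of_pos (mul_pos hdpt hn)
  rw [omegaF, waveAmp, ← Real.sqrt_mul (by positivity), waveShift, div_pow, mul_pow 2, hsq, hG]
  congr 1
  field_simp
  ring

/-- Under the momentum condition, two modes outside the tangential sites cannot cancel the
tangential ones; what is left has a positive first moment. -/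
theorem resonant_moment_lower_bound {ν : ℕ} {jbar : Fin ν → ℤ}
    (hjinj : Function.Injective fun a => |jbar a|) {ℓ : Fin ν → ℤ} {j j' : ℤ}
    (hj : j ≠ 0) (hjS : ∀ a, j ≠ jbar a) (hj' : j' ≠ 0) (hjS' : ∀ a, j' ≠ jbar a)
    (hmom : (∑ a, jbar a * ℓ a) + j + j' = 0)
    (hv : ∀ a, ℓ a + (if j.natAbs = (jbar a).natAbs then 1 else 0)
      + (if j'.natAbs = (jbar a).natAbs then 1 else 0) = 0)
    {W : ℕ → ℝ} {w : ℝ} (hw : 0 < w) (hW : ∀ n, 0 < n → w ≤ W n) :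
    w ≤ (∑ a, (ℓ a : ℝ) * W (jbar a).natAbs) + W j.natAbs + W j'.natAbs := by
  have match_eq {i : ℤ} (hi : ∀ a, i ≠ jbar a) {a : Fin ν} (h : i.natAbs = (jbar a).natAbs)
      (R : Type) [Ring R] (φ : Fin ν → R) :
      ∑ b, (if i.natAbs = (jbar b).natAbs then φ b else 0) = φ a := by
    rw [sum_eq_single a]
    · rw [if_pos h]
    · intro b _ hba
      refine if_neg fun hb => hba (hjinj ?_)
      simp only [Int.abs_eq_natAbs]
      rw [← hb, h]
    · simp
  have unmatched {i : ℤ} (h : ¬ ∃ a, i.natAbs = (jbar a).natAbs)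
      (φ : Fin ν → ℝ) : ∑ b, (if i.natAbs = (jbar b).natAbs then φ b else 0) = 0 :=
    sum_eq_zero fun b _ => if_neg fun hb => h ⟨b, hb⟩
  have expand (R : Type) [CommRing R] (φ : Fin ν → R) : ∑ a, (ℓ a : R) * φ a
      = -(∑ a, if j.natAbs = (jbar a).natAbs then φ a else 0)
        - ∑ a, if j'.natAbs = (jbar a).natAbs then φ a else 0 := by
    rw [← sum_neg_distrib, ← sum_sub_distrib]
    refine sum_congr rfl fun a _ => ?_
    have := hv a
    rw [show ℓ a = -(if j.natAbs = (jbar a).natAbs then 1 else 0)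
      - (if j'.natAbs = (jbar a).natAbs then 1 else 0) by linarith]
    split_ifs <;> push_cast <;> ring
  have hWj := hW _ (Int.natAbs_pos.2 hj)
  have hWj' := hW _ (Int.natAbs_pos.2 hj')
  rw [expand ℝ fun a => W (jbar a).natAbs]
  by_cases h : ∃ a, j.natAbs = (jbar a).natAbs
  · obtain ⟨a, ha⟩ := h
    rw [match_eq hjS ha ℝ, ← ha]
    by_cases h' : ∃ a, j'.natAbs = (jbar a).natAbs
    · obtain ⟨b, hb⟩ := h'
      exfalso
      have hja : j = -jbar a := (Int.natAbs_eq_natAbs_iff.1 ha).resolve_left (hjS a)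
      have hjb : j' = -jbar b := (Int.natAbs_eq_natAbs_iff.1 hb).resolve_left (hjS' b)
      have e := expand ℤ jbar
      rw [match_eq hjS ha ℤ, match_eq hjS' hb ℤ] at e
      simp only [Int.cast_id, mul_comm (ℓ _)] at e
      exact hjS' a (by omega)
    · rw [unmatched h']
      linarith
  · rw [unmatched h]
    by_cases h' : ∃ a, j'.natAbs = (jbar a).natAbs
    · obtain ⟨b, hb⟩ := h'
      rw [match_eq hjS' hb ℝ, ← hb]
      linarith
    · rw [unmatched h']
      linarith

theorem exists_norm_le_three_mul {ν : ℕ} (hν : 1 ≤ ν) (ℓ v : Fin ν → ℤ)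
    (h : ∀ a, |v a - ℓ a| ≤ 2) (hv : ∃ a, v a ≠ 0) :
    ∃ a, max 1 ‖ℓ‖ ≤ 3 * |(v a : ℝ)| := by
  have : Nonempty (Fin ν) := ⟨⟨0, hν⟩⟩
  obtain ⟨a, ha⟩ := Finite.exists_max fun a => |ℓ a|
  have hnorm : ‖ℓ‖ ≤ |(ℓ a : ℝ)| := by
    refine (pi_norm_le_iff_of_nonneg (abs_nonneg _)).2 fun b => ?_
    rw [Int.norm_eq_abs]
    exact_mod_cast ha b
  suffices ∃ b, 1 ≤ 3 * |v b| ∧ |ℓ a| ≤ 3 * |v b| by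
    obtain ⟨b, h1, h2⟩ := this
    exact ⟨b, max_le (by exact_mod_cast h1) (hnorm.trans (by exact_mod_cast h2))⟩
  by_cases hl : 3 ≤ |ℓ a|
  · refine ⟨a, ?_⟩
    have := h a
    grind
  · obtain ⟨b, hb⟩ := hv
    refine ⟨b, ?_⟩
    grind

/-- Transversality, second Melnikov conditions with sum (with momentum condition). -/
theorem transversality_2nd_Melnikov_sum
    (dpt g γ κ₁ κ₂ : ℝ) (hdpt : 0 < dpt) (hg : 0 < g) (hκ₁ : 0 < κ₁) (hκ₁₂ : κ₁ < κ₂)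
    (ν : ℕ) (hν : 1 ≤ ν) (jbar : Fin ν → ℤ)
    (hjne : ∀ a, jbar a ≠ 0)
    (hjinj : Function.Injective fun a => |jbar a|) :
    ∃ m₀ : ℕ, ∃ ρ₀ > (0 : ℝ), ∀ κ ∈ Set.Icc κ₁ κ₂, ∀ ℓ : Fin ν → ℤ, ∀ j j' : ℤ,
      j ≠ 0 → (∀ a, j ≠ jbar a) → j' ≠ 0 → (∀ a, j' ≠ jbar a) →
      (∑ a, jbar a * ℓ a) + j + j' = 0 →
      ∃ n ≤ m₀, ρ₀ * max 1 ‖ℓ‖ ≤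
        |iteratedDeriv n
          (fun κ' => (∑ a, (ℓ a : ℝ) * OmegaF dpt g γ (jbar a) κ')
            + OmegaF dpt g γ j κ' + OmegaF dpt g γ j' κ') κ| := by
  obtain ⟨w, hw, hwle⟩ := waveWeight_lower_bound γ hdpt hg hκ₁ hκ₁₂
  have hcoeff := fun a => abs_sum_coeff_le γ hdpt hg hκ₁ hκ₁₂ (Fin ν ⊕ Bool)
    (Int.natAbs_pos.2 (hjne a))
  choose r hr hrle using hcoeff
  have : Nonempty (Fin ν) := ⟨⟨0, hν⟩⟩
  obtain ⟨a₀, ha₀⟩ := Finite.exists_min r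
  set K := Fintype.card (Fin ν ⊕ Bool)
  set ρ := min w (r a₀) / 4 * (1 / 2) ^ (K + 1) with hρ
  have hmin : 0 < min w (r a₀) := lt_min hw (hr a₀)
  refine ⟨K + 1, ρ, by positivity, fun κ hκ ℓ j j' hj hjS hj' hjS' hmom => ?_⟩
  by_contra! hcon
  have hκ0 : 0 < κ := hκ₁.trans_le hκ.1
  set L := max 1 ‖ℓ‖
  have hL1 : 1 ≤ L := le_max_left _ _
  set N : Fin ν ⊕ Bool → ℕ := Sum.elim (fun a => (jbar a).natAbs)
    (fun b => if b then j.natAbs else j'.natAbs) with hN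
  set q : Fin ν ⊕ Bool → ℤ := Sum.elim ℓ (fun _ => 1) with hq
  have hNpos : ∀ i, 0 < N i := by
    rintro (a | _ | _)
    · exact Int.natAbs_pos.2 (hjne a)
    · exact Int.natAbs_pos.2 hj'
    · exact Int.natAbs_pos.2 hj
  have hF : (fun κ' => (∑ a, (ℓ a : ℝ) * OmegaF dpt g γ (jbar a) κ')
        + OmegaF dpt g γ j κ' + OmegaF dpt g γ j' κ')
      = fun t => (∑ i, (q i * waveAmp dpt (N i)) * √(t + waveShift dpt g γ (N i)))
        + ((∑ a, (ℓ a : ℝ) * (γ / 2 * Gfun dpt (jbar a) / (jbar a : ℝ)))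
          + γ / 2 * Gfun dpt j / (j : ℝ) + γ / 2 * Gfun dpt j' / (j' : ℝ)) := by
    funext t
    simp only [OmegaF, omegaF_eq dpt g γ hdpt (hjne _), omegaF_eq dpt g γ hdpt hj,
      omegaF_eq dpt g γ hdpt hj', Fintype.sum_sum_type, Fintype.sum_bool, hN, hq, Sum.elim_inl,
      Sum.elim_inr, mul_add, sum_add_distrib, if_true, Bool.false_eq_true, if_false, Int.cast_one,
      one_mul, mul_assoc]
    ring
  have hmoment : ∀ k ≤ K, |∑ i, (q i : ℝ) * waveWeight dpt g γ κ (N i) *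
      (κ + waveShift dpt g γ (N i))⁻¹ ^ k| ≤ min w (r a₀) / 4 * L := by
    intro k hk
    have h1 := hcon (k + 1) (by omega)
    rw [hF, iteratedDeriv_sum_sqrt _ _ (fun i => waveShift_pos γ hdpt hg (hNpos i)) _ k κ hκ0,
      abs_mul] at h1
    have h2 : (1 / 2 : ℝ) ^ (K + 1) ≤ |∏ m ∈ range (k + 1), (1 / 2 - (m : ℝ))| :=
      (pow_le_pow_of_le_one (by norm_num) (by norm_num) (by omega)).trans
        (half_pow_le_abs_prod (k + 1))
    have h3 : ∑ i, (q i : ℝ) * waveWeight dpt g γ κ (N i) *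
        (κ + waveShift dpt g γ (N i))⁻¹ ^ k = ∑ i, (q i * waveAmp dpt (N i)) *
        (√(κ + waveShift dpt g γ (N i)) * (κ + waveShift dpt g γ (N i))⁻¹ ^ (k + 1)) :=
      sum_congr rfl fun i _ => by rw [waveWeight]; ring
    rw [h3]
    refine le_of_mul_le_mul_left ?_ (by positivity : (0 : ℝ) < (1 / 2) ^ (K + 1))
    calc _ ≤ _ := mul_le_mul_of_nonneg_right h2 (abs_nonneg _)
      _ ≤ ρ * L := h1.le
      _ = _ := by rw [hρ]; ring
  set v : Fin ν → ℤ := fun a => ℓ a + (if j.natAbs = (jbar a).natAbs then 1 else 0)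
    + (if j'.natAbs = (jbar a).natAbs then 1 else 0) with hvdef
  have hvℓ : ∀ a, |v a - ℓ a| ≤ 2 := by
    intro a
    simp only [hvdef]
    split_ifs <;> grind
  have hvsum : ∀ a, (∑ i, if N i = (jbar a).natAbs then (q i : ℝ) else 0) = v a := by
    intro a
    rw [Fintype.sum_sum_type, Fintype.sum_bool, sum_eq_single a]
    · simp [hN, hq, hvdef, add_assoc]
    · intro b _ hba
      refine if_neg fun hb => hba (hjinj ?_)
      simp only [Int.abs_eq_natAbs]
      exact congrArg _ hb
    · simp
  by_cases hv : ∃ a, v a ≠ 0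
  · obtain ⟨a, ha⟩ := exists_norm_le_three_mul hν ℓ v hvℓ hv
    have h1 := hrle a κ hκ N hNpos (fun i => q i) _ hmoment
    rw [hvsum] at h1
    have h2 : min w (r a₀) ≤ r a := (min_le_right _ _).trans (ha₀ a)
    have h3 := mul_le_mul_of_nonneg_right h2 (abs_nonneg (v a : ℝ))
    have h4 := mul_le_mul_of_nonneg_left ha hmin.le
    have h5 := mul_pos hmin (one_pos.trans_le hL1)
    linarith
  · push Not at hv
    have h1 := resonant_moment_lower_bound hjinj hj hjS hj' hjS' hmom hv hw (hwle κ hκ)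
    have h2 := (le_abs_self _).trans (hmoment 0 (Nat.zero_le _))
    simp only [Fintype.sum_sum_type, Fintype.sum_bool, hN, hq, Sum.elim_inl, Sum.elim_inr, pow_zero,
      mul_one, if_true, Bool.false_eq_true, if_false, Int.cast_one, one_mul] at h2
    have h3 : L ≤ 2 := by
      refine max_le one_le_two ((pi_norm_le_iff_of_nonneg zero_le_two).2 fun a => ?_)
      have := hvℓ a
      rw [hv a, zero_sub, abs_neg] at this
      rw [Int.norm_eq_abs]
      exact_mod_cast this
    have h4 := mul_le_mul_of_nonneg_left h3 hmin.le
    linarith [min_le_left w (r a₀)]
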